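/- For each Turing functional Φ there is a Turing functional Ψ such that for all X ∈ 2^ω: (a) if Ψ^X is total then Φ^X is total, Ψ^X = Φ^X, and X is not Martin-Löf random relative to Ψ^X; and (b) if Φ^X is total and X is not Martin-Löf random relative to Φ^X, then Ψ^X is total. Moreover, an index for Ψ can be obtained effectively from an index for Φ. -/

import Mathlib

/-
Common framework: oracle (relative) partial computability via codes,
Turing reducibility, the jump, Cantor-space measure, Martin-Löf randomness
and genericity relative to an oracle, Turing functionals.
-/

open scoped ENNReal

namespace TypicalDegree

/-- Codes for partial functions recursive in an oracle (Kleene-style),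
    following `Nat.Partrec.Code` with an extra `oracle` constructor. -/
inductive OracleCode : Type
  | zero : OracleCode
  | succ : OracleCode
  | left : OracleCode
  | right : OracleCode
  | oracle : OracleCode
  | pair : OracleCode → OracleCode → OracleCode
  | comp : OracleCode → OracleCode → OracleCode
  | prec : OracleCode → OracleCode → OracleCode
  | rfind' : OracleCode → OracleCode

/-- Evaluation of an oracle code relative to an oracle `g : ℕ →. ℕ`. -/
def OracleCode.eval (g : ℕ →. ℕ) : OracleCode → ℕ →. ℕ
  | .zero => pure 0
  | .succ => Nat.succ
  | .left => ↑fun n : ℕ => n.unpair.1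
  | .right => ↑fun n : ℕ => n.unpair.2
  | .oracle => g
  | .pair cf cg => fun n => Nat.pair <$> OracleCode.eval g cf n <*> OracleCode.eval g cg n
  | .comp cf cg => fun n => OracleCode.eval g cg n >>= OracleCode.eval g cf
  | .prec cf cg =>
    Nat.unpaired fun a n =>
      n.rec (OracleCode.eval g cf a) fun y IH => do
        let i ← IH
        OracleCode.eval g cg (Nat.pair a (Nat.pair y i))
  | .rfind' cf =>
    Nat.unpaired fun a m =>
      (Nat.rfind fun n => (fun m => m = 0) <$> OracleCode.eval g cf (Nat.pair a (n + m))).map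
        (· + m)

/-- An effective injective numbering of oracle codes. -/
def OracleCode.encodeCode : OracleCode → ℕ
  | .zero => 0
  | .succ => 1
  | .left => 2
  | .right => 3
  | .oracle => 4
  | .pair cf cg => 4 * Nat.pair cf.encodeCode cg.encodeCode + 5
  | .comp cf cg => 4 * Nat.pair cf.encodeCode cg.encodeCode + 6
  | .prec cf cg => 4 * Nat.pair cf.encodeCode cg.encodeCode + 7
  | .rfind' cf => 4 * Nat.pair cf.encodeCode cf.encodeCode + 8

/-- The characteristic (total) oracle of an element of Cantor space. -/
def chi (X : ℕ → Bool) : ℕ →. ℕ := fun n => Part.some (cond (X n) 1 0)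

/-- `f` is partial recursive relative to the oracle `g`. -/
def RedIn (f g : ℕ →. ℕ) : Prop := ∃ c : OracleCode, c.eval g = f

/-- A total function `ℕ → ℕ` viewed as a partial function. -/
def natFun (f : ℕ → ℕ) : ℕ →. ℕ := fun n => Part.some (f n)

/-- Turing reducibility between elements of Cantor space. -/
def TRed (X Y : ℕ → Bool) : Prop := RedIn (chi X) (chi Y)

/-- Turing equivalence. -/
def TEquiv (X Y : ℕ → Bool) : Prop := TRed X Y ∧ TRed Y X

/-- `X` is computable. -/
def ComputableSeq (X : ℕ → Bool) : Prop := TRed X fun _ => false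

/-- `f : ℕ → ℕ` is computable. -/
def ComputableFun (f : ℕ → ℕ) : Prop := RedIn (natFun f) (chi fun _ => false)

/-- The Turing jump of `X`: the halting problem relative to `X`,
    under the numbering `encodeCode`. -/
noncomputable def jump (X : ℕ → Bool) : ℕ → Bool := fun n =>
  @decide (∃ c : OracleCode, c.encodeCode = n ∧ (c.eval (chi X) n).Dom) (Classical.dec _)

/-- `∅'`, the halting problem. -/
noncomputable def zeroJump : ℕ → Bool := jump fun _ => false

/-- `X` extends the finite binary string `σ` (i.e. `σ ⊂ X`). -/
def extendsStr (X : ℕ → Bool) (σ : List Bool) : Prop :=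
  ∀ i : Fin σ.length, X i.1 = σ.get i

/-- `⟦V⟧`: the open set of infinite sequences extending some string in `V`. -/
def openOf (V : Set (List Bool)) : Set (ℕ → Bool) := {X | ∃ σ ∈ V, extendsStr X σ}

/-- The (fair-coin) measure of the open set `⟦V⟧` determined by a set of strings `V`:
    the supremum over `n` of the proportion of length-`n` strings with a prefix in `V`. -/
noncomputable def stringMeasure (V : Set (List Bool)) : ℝ≥0∞ :=
  ⨆ n : ℕ, (Nat.card {f : Fin n → Bool // ∃ σ ∈ V, σ <+: List.ofFn f} : ℝ≥0∞) / 2 ^ n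

/-- The fair-coin (Lebesgue) measure on Cantor space, as the outer measure obtained from
    open coverings by sets of strings; it agrees with Lebesgue measure on measurable sets. -/
noncomputable def cantorMeasure (S : Set (ℕ → Bool)) : ℝ≥0∞ :=
  ⨅ (V : Set (List Bool)) (_ : S ⊆ openOf V), stringMeasure V

/-- `W` is computably enumerable relative to `X`. -/
def CEIn (X : ℕ → Bool) (W : Set (List Bool)) : Prop :=
  ∃ c : OracleCode, ∀ σ : List Bool, σ ∈ W ↔ (c.eval (chi X) (Encodable.encode σ)).Dom

/-- `W` is computably enumerable. -/
def CE (W : Set (List Bool)) : Prop := CEIn (fun _ => false) W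

/-- The c.e. set of strings with index `d`. -/
def ceSetOf (d : OracleCode) : Set (List Bool) :=
  {σ | (d.eval (chi fun _ => false) (Encodable.encode σ)).Dom}

/-- The sequence `V` of sets of strings is uniformly c.e. relative to `X`. -/
def UniformCEIn (X : ℕ → Bool) (V : ℕ → Set (List Bool)) : Prop :=
  ∃ c : OracleCode, ∀ (i : ℕ) (σ : List Bool),
    σ ∈ V i ↔ (c.eval (chi X) (Nat.pair i (Encodable.encode σ))).Dom

/-- A Martin-Löf test relative to `X`. -/
def MLTest (X : ℕ → Bool) (V : ℕ → Set (List Bool)) : Prop :=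
  UniformCEIn X V ∧ ∀ i : ℕ, stringMeasure (V i) < (2 : ℝ≥0∞)⁻¹ ^ i

/-- `Y` is Martin-Löf random relative to `X`. -/
def MLRandomIn (X Y : ℕ → Bool) : Prop :=
  ∀ V : ℕ → Set (List Bool), MLTest X V → ∃ i, Y ∉ openOf (V i)

/-- `Y` is 1-random. -/
def OneRandom (Y : ℕ → Bool) : Prop := MLRandomIn (fun _ => false) Y

/-- `Y` is 2-random: Martin-Löf random relative to `∅'`. -/
def TwoRandom (Y : ℕ → Bool) : Prop := MLRandomIn zeroJump Y

/-- `Y` is weakly 2-random: it avoids every null `Π⁰₂` class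
    (every null intersection of a uniformly c.e. sequence of open sets). -/
def Weak2Random (Y : ℕ → Bool) : Prop :=
  ∀ V : ℕ → Set (List Bool), UniformCEIn (fun _ => false) V →
    cantorMeasure (⋂ i, openOf (V i)) = 0 → Y ∉ ⋂ i, openOf (V i)

/-- `Y` is 1-generic relative to `X`. -/
def OneGenericIn (X Y : ℕ → Bool) : Prop :=
  ∀ W : Set (List Bool), CEIn X W →
    ∃ σ : List Bool, extendsStr Y σ ∧ (σ ∈ W ∨ ∀ τ : List Bool, σ <+: τ → τ ∉ W)

/-- `Y` is 1-generic. -/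
def OneGeneric (Y : ℕ → Bool) : Prop := OneGenericIn (fun _ => false) Y

/-- `Y` is 2-generic: 1-generic relative to `∅'`. -/
def TwoGeneric (Y : ℕ → Bool) : Prop := OneGenericIn zeroJump Y

/-- The Turing functional coded by `c` is total on oracle `X` with value `Y ∈ 2^ω`
    (i.e. `Ψ^X = Y`). -/
def FTotal (c : OracleCode) (X : ℕ → Bool) (Y : ℕ → Bool) : Prop :=
  c.eval (chi X) = chi Y

/-- `Ψ^X ⊇ σ`: the output of the functional `c` on oracle `X` extends the string `σ`. -/
def FExtends (c : OracleCode) (X : ℕ → Bool) (σ : List Bool) : Prop :=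
  ∀ i : Fin σ.length, c.eval (chi X) i.1 = Part.some (cond (σ.get i) 1 0)

/-- `π(Ψ,σ) = μ({X : Ψ^X ⊇ σ})`. -/
noncomputable def piMeasure (c : OracleCode) (σ : List Bool) : ℝ≥0∞ :=
  cantorMeasure {X | FExtends c X σ}

/-- A Turing functional is special if every infinite binary sequence
    in its range is incomputable. -/
def Special (c : OracleCode) : Prop :=
  ∀ X Y : ℕ → Bool, FTotal c X Y → ¬ ComputableSeq Y

/-- The code `c` computes the total function `T` on strings (no oracle). -/
def ComputesFun (c : OracleCode) (T : List Bool → Bool) : Prop :=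
  ∀ σ : List Bool, c.eval (chi fun _ => false) (Encodable.encode σ) = Part.some (cond (T σ) 1 0)

/-- `T` is (the characteristic function of) a tree: closed under prefixes. -/
def IsTree (T : List Bool → Bool) : Prop :=
  ∀ σ τ : List Bool, σ <+: τ → T τ = true → T σ = true

/-- The set of infinite paths through the tree `T`; `Π⁰₁` classes are the
    sets of paths through computable trees. -/
def pathsOf (T : List Bool → Bool) : Set (ℕ → Bool) :=
  {X | ∀ n : ℕ, T (List.ofFn fun i : Fin n => X i.1) = true}

/-- The computable join `X ⊕ Y`. -/
def join (X Y : ℕ → Bool) : ℕ → Bool := fun n =>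
  if n % 2 = 0 then X (n / 2) else Y (n / 2)

/-- A finite string used as a (partial) oracle. -/
def strOracle (τ : List Bool) : ℕ →. ℕ := fun n =>
  if h : n < τ.length then Part.some (cond (τ.get ⟨n, h⟩) 1 0) else Part.none

/-- `Ψ^{τ₀}` and `Ψ^{τ₁}` are incompatible: they give different outputs somewhere. -/
def SplitPair (c : OracleCode) (τ₀ τ₁ : List Bool) : Prop :=
  ∃ (n v₀ v₁ : ℕ), v₀ ∈ c.eval (strOracle τ₀) n ∧ v₁ ∈ c.eval (strOracle τ₁) n ∧ v₀ ≠ v₁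

/-- `(U,V)` is a `Ψ`-splitting above `τ`. -/
def SplittingAbove (c : OracleCode) (τ : List Bool) (U V : Finset (List Bool)) : Prop :=
  (∃ ℓ : ℕ, ∀ σ ∈ U ∪ V, σ.length = ℓ ∧ τ <+: σ) ∧
    ∀ σ₀ ∈ U, ∀ σ₁ ∈ V, SplitPair c σ₀ σ₁

/-- The output sequence `Ψ^X` of the functional `c` on oracle `X`
    (defaults to `false` when not total). -/
noncomputable def outSeq (c : OracleCode) (X : ℕ → Bool) : ℕ → Bool := fun n =>
  @dite _ (∃ Y : ℕ → Bool, FTotal c X Y) (Classical.dec _) (fun h => h.choose n) fun _ => false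

/-- `Ψ^X ↾ n`, as a finite string. -/
noncomputable def outStr (c : OracleCode) (X : ℕ → Bool) (n : ℕ) : List Bool :=
  List.ofFn fun i : Fin n => outSeq c X i.1

/-- The degree of `M` is a minimal Turing degree. -/
def MinimalDeg (M : ℕ → Bool) : Prop :=
  ¬ ComputableSeq M ∧ ∀ Z : ℕ → Bool, TRed Z M → ComputableSeq Z ∨ TRed M Z


/-! ### Basic facts about oracle codes -/

theorem mem_pair {g : ℕ →. ℕ} {cf cg : OracleCode} {n v : ℕ} :
    v ∈ (OracleCode.pair cf cg).eval g n ↔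
      ∃ a ∈ cf.eval g n, ∃ b ∈ cg.eval g n, Nat.pair a b = v := by
  have : (OracleCode.pair cf cg).eval g n =
    (Part.map Nat.pair (cf.eval g n)).bind fun f => (cg.eval g n).map f := rfl
  rw [this]
  simp [Part.mem_bind_iff, Part.mem_map_iff]

theorem mem_comp {g : ℕ →. ℕ} {cf cg : OracleCode} {n v : ℕ} :
    v ∈ (OracleCode.comp cf cg).eval g n ↔ ∃ a ∈ cg.eval g n, v ∈ cf.eval g a := by
  have : (OracleCode.comp cf cg).eval g n = (cg.eval g n).bind (cf.eval g) := rfl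
  rw [this]
  exact Part.mem_bind_iff

theorem eval_prec_zero {g : ℕ →. ℕ} {cf cg : OracleCode} {a : ℕ} :
    (OracleCode.prec cf cg).eval g (Nat.pair a 0) = cf.eval g a := by
  simp only [OracleCode.eval, Nat.unpaired, Nat.unpair_pair]
  rfl

theorem mem_prec_succ {g : ℕ →. ℕ} {cf cg : OracleCode} {a m v : ℕ} :
    v ∈ (OracleCode.prec cf cg).eval g (Nat.pair a (m + 1)) ↔
      ∃ i ∈ (OracleCode.prec cf cg).eval g (Nat.pair a m),
        v ∈ cg.eval g (Nat.pair a (Nat.pair m i)) := by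
  have : (OracleCode.prec cf cg).eval g (Nat.pair a (m + 1)) =
      ((OracleCode.prec cf cg).eval g (Nat.pair a m)).bind
        fun i => cg.eval g (Nat.pair a (Nat.pair m i)) := by
    simp only [OracleCode.eval, Nat.unpaired, Nat.unpair_pair]
    rfl
  rw [this]
  simp [Part.mem_bind_iff]

theorem mem_rfind' {g : ℕ →. ℕ} {cf : OracleCode} {a m v : ℕ} :
    v ∈ (OracleCode.rfind' cf).eval g (Nat.pair a m) ↔
      ∃ k, (0 ∈ cf.eval g (Nat.pair a (k + m)) ∧
        ∀ j < k, ∃ b ∈ cf.eval g (Nat.pair a (j + m)), b ≠ 0) ∧ k + m = v := by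
  have : (OracleCode.rfind' cf).eval g (Nat.pair a m) =
      (Nat.rfind fun n => (cf.eval g (Nat.pair a (n + m))).map
        (fun m => decide (m = 0))).map (· + m) := by
    simp only [OracleCode.eval, Nat.unpaired, Nat.unpair_pair]
    rfl
  rw [this]
  refine (Part.mem_map_iff _).trans ?_
  refine exists_congr fun k => and_congr_left fun _ => ?_
  refine Nat.mem_rfind.trans ?_
  simp [Part.mem_map_iff]

open Filter in
theorem eval_cont {G : ℕ → ℕ →. ℕ} {g : ℕ →. ℕ}
    (hG : ∀ n v, v ∈ g n → ∀ᶠ t in atTop, v ∈ G t n) (c : OracleCode) :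
    ∀ n v, v ∈ c.eval g n → ∀ᶠ t in atTop, v ∈ c.eval (G t) n := by
  induction c with
  | zero => intro n v h; exact Eventually.of_forall fun t => h
  | succ => intro n v h; exact Eventually.of_forall fun t => h
  | left => intro n v h; exact Eventually.of_forall fun t => h
  | right => intro n v h; exact Eventually.of_forall fun t => h
  | oracle => exact hG
  | pair cf cg hf hg =>
    intro n v h
    obtain ⟨a, ha, b, hb, rfl⟩ := mem_pair.1 h
    filter_upwards [hf _ _ ha, hg _ _ hb] with t h1 h2
    exact mem_pair.2 ⟨a, h1, b, h2, rfl⟩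
  | comp cf cg hf hg =>
    intro n v h
    obtain ⟨a, ha, hb⟩ := mem_comp.1 h
    filter_upwards [hg _ _ ha, hf _ _ hb] with t h1 h2
    exact mem_comp.2 ⟨a, h1, h2⟩
  | prec cf cg hf hg =>
    intro n v h
    obtain ⟨a, m, rfl⟩ : ∃ a m, n = Nat.pair a m := ⟨_, _, (Nat.pair_unpair n).symm⟩
    induction m generalizing v with
    | zero =>
      simp only [eval_prec_zero] at h ⊢
      exact hf _ _ h
    | succ m ih =>
      obtain ⟨i, hi, hv⟩ := mem_prec_succ.1 h
      filter_upwards [ih _ hi, hg _ _ hv] with t h1 h2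
      exact mem_prec_succ.2 ⟨i, h1, h2⟩
  | rfind' cf hf =>
    intro n v h
    obtain ⟨a, m, rfl⟩ : ∃ a m, n = Nat.pair a m := ⟨_, _, (Nat.pair_unpair n).symm⟩
    obtain ⟨k, ⟨ha, hlt⟩, rfl⟩ := mem_rfind'.1 h
    have h2 : ∀ᶠ t in atTop, ∀ j ∈ {j | j < k}, ∃ b, b ∈ cf.eval (G t)
        (Nat.pair a (j + m)) ∧ b ≠ 0 := by
      rw [(Set.finite_lt_nat k).eventually_all]
      intro j hj
      obtain ⟨b, hb, hb'⟩ := hlt j hj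
      filter_upwards [hf _ _ hb] with t h1
      exact ⟨b, h1, hb'⟩
    filter_upwards [hf _ _ ha, h2] with t h1 h2
    exact mem_rfind'.2 ⟨k, ⟨h1, h2⟩, rfl⟩

theorem eval_mono {g g' : ℕ →. ℕ} (h : ∀ n v, v ∈ g n → v ∈ g' n) (c : OracleCode)
    {n v} (hv : v ∈ c.eval g n) : v ∈ c.eval g' n := by
  have := eval_cont (G := fun _ => g') (g := g)
    (fun n v hv => Filter.Eventually.of_forall fun _ => h n v hv) c n v hv
  exact Filter.eventually_const.1 this

/-- Embed plain codes into oracle codes. -/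
def lift : Nat.Partrec.Code → OracleCode
  | .zero => .zero
  | .succ => .succ
  | .left => .left
  | .right => .right
  | .pair a b => .pair (lift a) (lift b)
  | .comp a b => .comp (lift a) (lift b)
  | .prec a b => .prec (lift a) (lift b)
  | .rfind' a => .rfind' (lift a)

theorem eval_lift (g : ℕ →. ℕ) (c : Nat.Partrec.Code) : (lift c).eval g = c.eval := by
  induction c with
  | zero => rfl
  | succ => rfl
  | left => rfl
  | right => rfl
  | pair a b ha hb => simp only [lift, OracleCode.eval, Nat.Partrec.Code.eval, ha, hb]; rfl
  | comp a b ha hb => simp only [lift, OracleCode.eval, Nat.Partrec.Code.eval, ha, hb]; rfl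
  | prec a b ha hb => simp only [lift, OracleCode.eval, Nat.Partrec.Code.eval, ha, hb]; rfl
  | rfind' a ha => simp only [lift, OracleCode.eval, Nat.Partrec.Code.eval, ha]; rfl

theorem exists_lift {f : ℕ →. ℕ} (hf : Nat.Partrec f) :
    ∃ c : OracleCode, ∀ g, c.eval g = f := by
  obtain ⟨c, rfl⟩ := Nat.Partrec.Code.exists_code.1 hf
  exact ⟨lift c, fun g => eval_lift g c⟩

/-- Replace the oracle by a plain code. -/
def tr (o : Nat.Partrec.Code) : OracleCode → Nat.Partrec.Code
  | .zero => .zero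
  | .succ => .succ
  | .left => .left
  | .right => .right
  | .oracle => o
  | .pair a b => .pair (tr o a) (tr o b)
  | .comp a b => .comp (tr o a) (tr o b)
  | .prec a b => .prec (tr o a) (tr o b)
  | .rfind' a => .rfind' (tr o a)

theorem eval_tr (o : Nat.Partrec.Code) (c : OracleCode) : (tr o c).eval = c.eval o.eval := by
  induction c with
  | zero => rfl
  | succ => rfl
  | left => rfl
  | right => rfl
  | oracle => rfl
  | pair a b ha hb => simp only [tr, OracleCode.eval, Nat.Partrec.Code.eval, ha, hb]; rfl
  | comp a b ha hb => simp only [tr, OracleCode.eval, Nat.Partrec.Code.eval, ha, hb]; rfl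
  | prec a b ha hb => simp only [tr, OracleCode.eval, Nat.Partrec.Code.eval, ha, hb]; rfl
  | rfind' a ha => simp only [tr, OracleCode.eval, Nat.Partrec.Code.eval, ha]; rfl

/-- `tr` on indices, as a one-step recursion over the list of previous values. -/
def trStep (o : Nat.Partrec.Code) (l : List Nat.Partrec.Code) : Nat.Partrec.Code :=
  let n := l.length
  if n = 0 then .zero else if n = 1 then .succ else if n = 2 then .left else
  if n = 3 then .right else if n = 4 then o else
    let q := ((n - 5) / 4).unpair
    let a := l.getD q.1 .zero
    let b := l.getD q.2 .zero
    if (n - 5) % 4 = 0 then .pair a b else if (n - 5) % 4 = 1 then .comp a b else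
    if (n - 5) % 4 = 2 then .prec a b else .rfind' a

theorem primrec_trStep : Primrec₂ trStep := by
  open Primrec in
  have hl : Primrec fun p : Nat.Partrec.Code × List Nat.Partrec.Code => p.2.length :=
    list_length.comp snd
  have hm : Primrec fun p : Nat.Partrec.Code × List Nat.Partrec.Code => p.2.length - 5 :=
    nat_sub.comp hl (const 5)
  have hq : Primrec fun p : Nat.Partrec.Code × List Nat.Partrec.Code =>
      ((p.2.length - 5) / 4).unpair := unpair.comp (nat_div.comp hm (const 4))
  have hr : Primrec fun p : Nat.Partrec.Code × List Nat.Partrec.Code =>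
      (p.2.length - 5) % 4 := nat_mod.comp hm (const 4)
  have ha : Primrec fun p : Nat.Partrec.Code × List Nat.Partrec.Code =>
      p.2.getD ((p.2.length - 5) / 4).unpair.1 .zero :=
    (list_getD Nat.Partrec.Code.zero).comp snd (fst.comp hq)
  have hb : Primrec fun p : Nat.Partrec.Code × List Nat.Partrec.Code =>
      p.2.getD ((p.2.length - 5) / 4).unpair.2 .zero :=
    (list_getD Nat.Partrec.Code.zero).comp snd (snd.comp hq)
  exact ite (Primrec.eq.comp hl (const 0)) (const _) <|
    ite (Primrec.eq.comp hl (const 1)) (const _) <|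
    ite (Primrec.eq.comp hl (const 2)) (const _) <|
    ite (Primrec.eq.comp hl (const 3)) (const _) <|
    ite (Primrec.eq.comp hl (const 4)) fst <|
    ite (Primrec.eq.comp hr (const 0)) (Nat.Partrec.Code.primrec₂_pair.comp ha hb) <|
    ite (Primrec.eq.comp hr (const 1)) (Nat.Partrec.Code.primrec₂_comp.comp ha hb) <|
    ite (Primrec.eq.comp hr (const 2)) (Nat.Partrec.Code.primrec₂_prec.comp ha hb) <|
    Nat.Partrec.Code.primrec_rfind'.comp ha

/-- `tr` on indices: the list of the first `n` values. -/
def trList (o : Nat.Partrec.Code) : ℕ → List Nat.Partrec.Code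
  | 0 => []
  | n + 1 => trList o n ++ [trStep o (trList o n)]

/-- `tr` on indices. -/
def trN (o : Nat.Partrec.Code) (n : ℕ) : Nat.Partrec.Code := trStep o (trList o n)

theorem trList_eq (o) (n) : trList o n = (List.range n).map (trN o) := by
  induction n with
  | zero => rfl
  | succ n ih =>
    rw [List.range_succ, List.map_append, ← ih]; rfl

theorem primrec_trN : Primrec₂ trN := by
  refine Primrec.nat_strong_rec trN (g := fun o l => some (trStep o l))
    (Primrec.option_some.comp primrec_trStep) fun o n => ?_
  rw [← trList_eq]; rfl

theorem trN_encode (o : Nat.Partrec.Code) (c : OracleCode) : trN o c.encodeCode = tr o c := by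
  have key : ∀ n q, q < n → (trList o n).getD q .zero = trN o q := by
    intro n q h
    rw [trList_eq]
    simp [List.getD, h]
  have hlen : ∀ n, (trList o n).length = n := by intro n; rw [trList_eq]; simp
  have lt1 : ∀ a b k, 5 ≤ k → a < 4 * Nat.pair a b + k := fun a b k h => by
    have := Nat.left_le_pair a b; omega
  have lt2 : ∀ a b k, 5 ≤ k → b < 4 * Nat.pair a b + k := fun a b k h => by
    have := Nat.right_le_pair a b; omega
  induction c with
  | zero => rfl
  | succ => rfl
  | left => rfl
  | right => rfl
  | oracle => rfl
  | pair a b ha hb =>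
    rw [OracleCode.encodeCode, tr, trN, trStep]
    simp only [hlen]
    have e1 : (4 * Nat.pair a.encodeCode b.encodeCode + 5 - 5) / 4 =
      Nat.pair a.encodeCode b.encodeCode := by omega
    have e2 : (4 * Nat.pair a.encodeCode b.encodeCode + 5 - 5) % 4 = 0 := by omega
    rw [e1, e2, Nat.unpair_pair, key _ _ (lt1 _ _ _ (by omega)), key _ _ (lt2 _ _ _ (by omega)),
      ha, hb]
    simp
  | comp a b ha hb =>
    rw [OracleCode.encodeCode, tr, trN, trStep]
    simp only [hlen]
    have e1 : (4 * Nat.pair a.encodeCode b.encodeCode + 6 - 5) / 4 =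
      Nat.pair a.encodeCode b.encodeCode := by omega
    have e2 : (4 * Nat.pair a.encodeCode b.encodeCode + 6 - 5) % 4 = 1 := by omega
    rw [e1, e2, Nat.unpair_pair, key _ _ (lt1 _ _ _ (by omega)), key _ _ (lt2 _ _ _ (by omega)),
      ha, hb]
    simp
  | prec a b ha hb =>
    rw [OracleCode.encodeCode, tr, trN, trStep]
    simp only [hlen]
    have e1 : (4 * Nat.pair a.encodeCode b.encodeCode + 7 - 5) / 4 =
      Nat.pair a.encodeCode b.encodeCode := by omega
    have e2 : (4 * Nat.pair a.encodeCode b.encodeCode + 7 - 5) % 4 = 2 := by omega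
    rw [e1, e2, Nat.unpair_pair, key _ _ (lt1 _ _ _ (by omega)), key _ _ (lt2 _ _ _ (by omega)),
      ha, hb]
    simp
  | rfind' a ha =>
    rw [OracleCode.encodeCode, tr, trN, trStep]
    simp only [hlen]
    have e1 : (4 * Nat.pair a.encodeCode a.encodeCode + 8 - 5) / 4 =
      Nat.pair a.encodeCode a.encodeCode := by omega
    have e2 : (4 * Nat.pair a.encodeCode a.encodeCode + 8 - 5) % 4 = 3 := by omega
    rw [e1, e2, Nat.unpair_pair, key _ _ (lt1 _ _ _ (by omega)), ha]
    simp

/-! ### The universal test: the decidable core -/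

/-- The restriction of `Y` to its first `n` bits. -/
def rs (Y : ℕ → Bool) (n : ℕ) : List Bool := (List.range n).map Y

theorem exists_partrec_code {α β : Type} [Primcodable α] [Primcodable β] {f : α →. β}
    (hf : Partrec f) : ∃ o : Nat.Partrec.Code, ∀ a : α,
      o.eval (Encodable.encode a) = (f a).map Encodable.encode := by
  obtain ⟨o, ho⟩ := Nat.Partrec.Code.exists_code.1 hf
  refine ⟨o, fun a => ?_⟩
  have h : o.eval (Encodable.encode a) = Part.bind
      ((Encodable.decode (Encodable.encode a) : Option α) : Part α)
      (fun a => (f a).map Encodable.encode) := congrFun ho _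
  rw [h, Encodable.encodek]
  exact Part.bind_some _ _

theorem exists_prim_code {α β : Type} [Primcodable α] [Primcodable β] {f : α → β}
    (hf : Primrec f) : ∃ c : OracleCode, ∀ (g : ℕ →. ℕ) (a : α),
      Encodable.encode (f a) ∈ c.eval g (Encodable.encode a) := by
  obtain ⟨o, ho⟩ := exists_partrec_code hf.to_comp
  refine ⟨lift o, fun g a => ?_⟩
  have h := ho a
  rw [← eval_lift g o] at h
  have h2 : Encodable.encode (f a) ∈ (Part.some (f a)).map Encodable.encode :=
    Part.mem_map _ (Part.mem_some _)
  exact h ▸ h2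

theorem exists_strCode : ∃ o : Nat.Partrec.Code, ∀ (τ : List Bool) (n : ℕ),
    o.eval (Nat.pair (Encodable.encode τ) n) = strOracle τ n := by
  have h1 : Primrec fun p : List Bool × ℕ => (p.1[p.2]?).map fun b => cond b 1 0 :=
    Primrec.option_map Primrec.list_getElem?
      (Primrec.cond Primrec.snd (Primrec.const 1) (Primrec.const 0))
  obtain ⟨o, ho⟩ := exists_partrec_code h1.to_comp.ofOption
  refine ⟨o, fun τ n => (ho (τ, n)).trans ?_⟩
  apply Part.ext
  intro v
  by_cases h : n < τ.length
  · have : strOracle τ n = Part.some (cond (τ.get ⟨n, h⟩) 1 0) := dif_pos h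
    rw [this]
    simp [h]
  · have : strOracle τ n = Part.none := dif_neg h
    rw [this]
    simp [h]

/-- A plain code for the oracle given by a string. -/
noncomputable def strCode (τ : List Bool) : Nat.Partrec.Code :=
  exists_strCode.choose.curry (Encodable.encode τ)

theorem eval_strCode (τ : List Bool) : (strCode τ).eval = strOracle τ := by
  funext n
  rw [strCode, Nat.Partrec.Code.eval_curry, exists_strCode.choose_spec]

theorem primrec_strCode : Primrec strCode :=
  Nat.Partrec.Code.primrec₂_curry.comp (Primrec.const _) Primrec.encode

/-- `σ` is enumerated into component `i` of the `e`-th test with oracle string `τ` in `k` steps. -/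
def RR (e i : ℕ) (σ τ : List Bool) (k : ℕ) : Prop :=
  ((trN (strCode τ) e).evaln k (Nat.pair i (Encodable.encode σ))).isSome = true

theorem exists_RR (c : OracleCode) (i : ℕ) (σ τ : List Bool) :
    (∃ k, RR c.encodeCode i σ τ k) ↔
      (c.eval (strOracle τ) (Nat.pair i (Encodable.encode σ))).Dom := by
  simp only [RR, trN_encode]
  rw [Part.dom_iff_mem, ← eval_strCode, ← eval_tr]
  simp only [Nat.Partrec.Code.evaln_complete, Option.isSome_iff_exists, Option.mem_def]
  exact exists_comm

/-- Some prefix of `ρ` is enumerated by stage `|τ|` using a prefix of `τ` as oracle. -/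
def QQ (e i : ℕ) (ρ τ : List Bool) : Prop :=
  ∃ a < ρ.length + 1, ∃ t < τ.length + 1, ∃ k < τ.length + 1, RR e i (ρ.take a) (τ.take t) k

theorem prim_exists_lt {α : Type} [Primcodable α] {b : α → ℕ} {p : ℕ × α → Prop}
    (hb : Primrec b) (hp : PrimrecPred p) : PrimrecPred fun a => ∃ x < b a, p (x, a) :=
  ((PrimrecRel.exists_mem_list (R := fun x a => p (x, a)) hp.primrecRel).comp
    (Primrec.list_range.comp hb) Primrec.id).of_eq (by simp)

theorem primrec_RR : PrimrecPred fun p : ℕ × ℕ × List Bool × List Bool × ℕ =>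
    RR p.1 p.2.1 p.2.2.1 p.2.2.2.1 p.2.2.2.2 := by
  open Primrec in
  refine Primrec.eq.comp (β := Bool) ?_ (const true)
  refine option_isSome.comp ?_
  refine Nat.Partrec.Code.primrec_evaln.comp (((snd.comp <| snd.comp <| snd.comp snd).pair ?_).pair ?_)
  · exact primrec_trN.comp (primrec_strCode.comp (fst.comp <| snd.comp <| snd.comp snd)) fst
  · exact Primrec₂.natPair.comp (fst.comp snd) (Primrec.encode.comp (fst.comp <| snd.comp snd))

theorem primrec_QQ : PrimrecPred fun p : ℕ × ℕ × List Bool × List Bool =>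
    QQ p.1 p.2.1 p.2.2.1 p.2.2.2 := by
  open Primrec in
  have h0 : PrimrecPred fun q : ℕ × ℕ × ℕ × ℕ × ℕ × List Bool × List Bool =>
      RR q.2.2.2.1 q.2.2.2.2.1 (q.2.2.2.2.2.1.take q.2.2.1) (q.2.2.2.2.2.2.take q.2.1) q.1 := by
    have hp : Primrec fun q : ℕ × ℕ × ℕ × ℕ × ℕ × List Bool × List Bool => q.2.2.2 :=
      snd.comp (snd.comp snd)
    exact primrec_RR.comp ((fst.comp hp).pair <| (fst.comp <| snd.comp hp).pair <|
      (list_take.comp (fst.comp <| snd.comp snd) (fst.comp <| snd.comp <| snd.comp hp)).pair <|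
      (list_take.comp (fst.comp snd) (snd.comp <| snd.comp <| snd.comp hp)).pair fst)
  have h1 := prim_exists_lt
    (b := fun q : ℕ × ℕ × ℕ × ℕ × List Bool × List Bool => q.2.2.2.2.2.length + 1)
    (Primrec.succ.comp (list_length.comp <| snd.comp <| snd.comp <| snd.comp <| snd.comp snd)) h0
  have h2 := prim_exists_lt
    (b := fun q : ℕ × ℕ × ℕ × List Bool × List Bool => q.2.2.2.2.length + 1)
    (Primrec.succ.comp (list_length.comp <| snd.comp <| snd.comp <| snd.comp snd)) h1
  exact prim_exists_lt
    (b := fun q : ℕ × ℕ × List Bool × List Bool => q.2.2.1.length + 1)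
    (Primrec.succ.comp (list_length.comp <| fst.comp <| snd.comp snd)) h2

/-- All strings of length `n`. -/
def strs : ℕ → List (List Bool)
  | 0 => [[]]
  | n + 1 => (strs n).map (List.cons false) ++ (strs n).map (List.cons true)

theorem primrec_strs : Primrec strs := by
  open Primrec in
  have hc : ∀ b : Bool, Primrec fun p : ℕ × List (List Bool) => p.2.map (List.cons b) := fun b =>
    list_map snd (list_cons.comp (const b) snd)
  have : Primrec₂ fun (_ : ℕ) (L : List (List Bool)) =>
      L.map (List.cons false) ++ L.map (List.cons true) :=
    list_append.comp (hc false) (hc true)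
  refine (nat_rec₁ [[]] this).of_eq fun n => ?_
  induction n with
  | zero => rfl
  | succ n ih => simp only [strs, ← ih]

open Classical in
/-- The number of strings of length `n` satisfying `P`. -/
noncomputable def CC (P : List Bool → Prop) (n : ℕ) : ℕ := ((strs n).filter (fun l => P l)).length

/-- The stage-`|τ|` approximation to the measure, scaled by `2 ^ |τ|`. -/
noncomputable def cnt (e i : ℕ) (τ : List Bool) : ℕ := CC (fun l => QQ e i l τ) τ.length

theorem primrec_cnt : Primrec fun p : ℕ × ℕ × List Bool => cnt p.1 p.2.1 p.2.2 := by
  classical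
  open Primrec in
  have h : PrimrecRel fun (l : List Bool) (p : ℕ × ℕ × List Bool) => QQ p.1 p.2.1 l p.2.2 :=
    primrec_QQ.comp ((fst.comp snd).pair <| (fst.comp <| snd.comp snd).pair <| fst.pair <|
      snd.comp <| snd.comp snd)
  refine (list_length.comp (h.listFilter.comp
    (primrec_strs.comp <| list_length.comp <| snd.comp snd) .id)).of_eq fun p => ?_
  simp only [cnt, CC]
  congr!

/-- The measure approximation is still small. -/
def good (e i : ℕ) (τ : List Bool) : Prop := cnt e i τ * 2 ^ i < 2 ^ τ.length

theorem primrec_two_pow : Primrec fun n : ℕ => 2 ^ n := by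
  refine (Primrec.nat_rec₁ (f := fun _ m => m * 2) 1
    (Primrec.nat_mul.comp Primrec.snd (Primrec.const 2))).of_eq fun n => ?_
  induction n with
  | zero => rfl
  | succ n ih => simp only [pow_succ, ← ih]

/-- `ρ` is in the `n`-th component of the universal test, relative to the oracle string `τ`. -/
def HH (n : ℕ) (ρ τ : List Bool) : Prop :=
  ∃ e < τ.length, QQ e (n + e + 2) ρ τ ∧ good e (n + e + 2) τ

theorem primrec_HH : PrimrecPred fun p : ℕ × List Bool × List Bool => HH p.1 p.2.1 p.2.2 := by
  open Primrec in
  refine prim_exists_lt (b := fun q : ℕ × List Bool × List Bool => q.2.2.length)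
    (p := fun q => QQ q.1 (q.2.1 + q.1 + 2) q.2.2.1 q.2.2.2 ∧ good q.1 (q.2.1 + q.1 + 2) q.2.2.2)
    (list_length.comp <| snd.comp snd) ?_
  have hi : Primrec fun q : ℕ × ℕ × List Bool × List Bool => q.2.1 + q.1 + 2 :=
    nat_add.comp (nat_add.comp (fst.comp snd) fst) (const 2)
  have ht : Primrec fun q : ℕ × ℕ × List Bool × List Bool => q.2.2.2 := snd.comp <| snd.comp snd
  refine PrimrecPred.and ?_ ?_
  · exact primrec_QQ.comp (fst.pair <| hi.pair <| snd.comp snd)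
  · exact nat_lt.comp (nat_mul.comp (primrec_cnt.comp (fst.pair <| hi.pair ht))
      (primrec_two_pow.comp hi)) (primrec_two_pow.comp (list_length.comp ht))

/-! ### Counting strings -/

theorem mem_strs {n : ℕ} {l : List Bool} : l ∈ strs n ↔ l.length = n := by
  induction n generalizing l with
  | zero => simp [strs]
  | succ n ih =>
    cases l with
    | nil => simp [strs]
    | cons b l => cases b <;> simp [strs, ih]

theorem nodup_strs (n : ℕ) : (strs n).Nodup := by
  induction n with
  | zero => simp [strs]
  | succ n ih =>
    rw [strs, List.nodup_append]
    refine ⟨ih.map List.cons_injective, ih.map List.cons_injective, ?_⟩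
    intro a ha b hb
    simp only [List.mem_map] at ha hb
    obtain ⟨a, _, rfl⟩ := ha
    obtain ⟨b, _, rfl⟩ := hb
    simp

theorem CC_mono {P P' : List Bool → Prop} {n : ℕ} (h : ∀ l, l.length = n → P l → P' l) :
    CC P n ≤ CC P' n := by
  classical
  unfold CC
  rw [← List.countP_eq_length_filter, ← List.countP_eq_length_filter]
  refine List.countP_mono_left fun l hl => ?_
  simpa using h l (mem_strs.1 hl)

theorem CC_succ (P : List Bool → Prop) (n : ℕ) :
    CC P (n + 1) = CC (fun l => P (false :: l)) n + CC (fun l => P (true :: l)) n := by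
  classical
  unfold CC
  simp only [strs, List.filter_append, List.length_append, List.filter_map, List.length_map]
  rfl

theorem CC_true (n : ℕ) (p : Prop) [Decidable p] :
    CC (fun _ => p) n = 2 ^ n * (if p then 1 else 0) := by
  induction n with
  | zero => by_cases h : p <;> simp [CC, strs, h]
  | succ n ih => rw [CC_succ, ih]; ring

theorem CC_take (P : List Bool → Prop) (s d : ℕ) :
    CC (fun l => P (l.take s)) (s + d) = 2 ^ d * CC P s := by
  classical
  induction s generalizing P with
  | zero =>
    simp only [List.take_zero, Nat.zero_add]
    rw [CC_true]
    congr 1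
    by_cases h : P [] <;> simp [CC, strs, h]
  | succ s ih =>
    have e : s + 1 + d = (s + d) + 1 := by ring
    rw [e, CC_succ, CC_succ]
    simp only [List.take_succ_cons]
    rw [ih (fun l => P (false :: l)), ih (fun l => P (true :: l))]
    ring

theorem CC_union (P : ℕ → List Bool → Prop) (n N : ℕ) :
    CC (fun l => ∃ e < N, P e l) n ≤ ∑ e ∈ Finset.range N, CC (P e) n := by
  classical
  induction N with
  | zero => simp [CC]
  | succ N ih =>
    rw [Finset.sum_range_succ]
    refine le_trans ?_ (Nat.add_le_add_right ih _)
    unfold CC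
    simp only [← List.countP_eq_length_filter]
    generalize strs n = L
    induction L with
    | nil => simp
    | cons l L ih =>
      simp only [List.countP_cons, decide_eq_true_eq]
      have : (∃ e < N + 1, P e l) ↔ (∃ e < N, P e l) ∨ P N l := by
        constructor
        · rintro ⟨e, he, h⟩
          rcases Nat.lt_succ_iff_lt_or_eq.1 he with h1 | rfl
          · exact .inl ⟨e, h1, h⟩
          · exact .inr h
        · rintro (⟨e, he, h⟩ | h)
          · exact ⟨e, by omega, h⟩
          · exact ⟨N, by omega, h⟩
      rw [if_congr this rfl rfl]
      by_cases h1 : ∃ e < N, P e l <;> by_cases h2 : P N l <;> simp only [h1, h2, if_true, if_false,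
        or_true, or_false] <;> omega

theorem card_eq_CC (P : List Bool → Prop) (n : ℕ) :
    Nat.card {f : Fin n → Bool // P (List.ofFn f)} = CC P n := by
  classical
  rw [Nat.card_eq_fintype_card, Fintype.card_subtype]
  unfold CC
  rw [← List.toFinset_card_of_nodup ((nodup_strs n).filter _)]
  refine Finset.card_bij (fun f _ => List.ofFn f) ?_ ?_ ?_
  · intro f hf
    simpa [mem_strs] using hf
  · intro f _ g _ h
    exact List.ofFn_injective h
  · intro l hl
    simp only [List.mem_toFinset, List.mem_filter, mem_strs, decide_eq_true_eq] at hl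
    obtain ⟨rfl, hl⟩ := hl
    exact ⟨l.get, by simpa using hl, by simp⟩

/-! ### The measure bound for the universal test -/

theorem length_rs (Y : ℕ → Bool) (n : ℕ) : (rs Y n).length = n := by simp [rs]

theorem take_rs (Y : ℕ → Bool) {m n : ℕ} (h : m ≤ n) : (rs Y n).take m = rs Y m := by
  rw [rs, rs, ← List.map_take, List.take_range, min_eq_left h]

theorem QQ_mono {e i : ℕ} {ρ τ : List Bool} {s t : ℕ} (h : QQ e i (ρ.take s) (τ.take s))
    (hst : s ≤ t) : QQ e i (ρ.take t) (τ.take t) := by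
  obtain ⟨a, ha, b, hb, k, hk, h⟩ := h
  simp only [List.length_take] at ha hb hk
  refine ⟨a, ?_, b, ?_, k, ?_, ?_⟩
  · simp only [List.length_take]; omega
  · simp only [List.length_take]; omega
  · simp only [List.length_take]; omega
  · rw [List.take_take, List.take_take] at h ⊢
    rw [min_eq_left (by omega)] at h ⊢
    rw [min_eq_left (by omega)] at h ⊢
    exact h

/-- The universal test relative to `Y`. -/
def UU (Y : ℕ → Bool) (n : ℕ) : Set (List Bool) := {ρ | HH n ρ (rs Y ρ.length)}

theorem CC_piece (Y : ℕ → Bool) (e i m : ℕ) :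
    CC (fun l => ∃ s ≤ m, QQ e i (l.take s) (rs Y s) ∧ good e i (rs Y s)) m * 2 ^ i ≤ 2 ^ m := by
  classical
  by_cases hex : ∃ s ≤ m, good e i (rs Y s)
  · obtain ⟨s, hs, hg, hmax⟩ : ∃ s ≤ m, good e i (rs Y s) ∧
        ∀ t ≤ m, good e i (rs Y t) → t ≤ s := by
      obtain ⟨s0, h0, hg0⟩ := hex
      refine ⟨Nat.findGreatest (fun s => good e i (rs Y s)) m, Nat.findGreatest_le _,
        Nat.findGreatest_spec (P := fun s => good e i (rs Y s)) h0 hg0, fun t ht hgt => Nat.le_findGreatest ht hgt⟩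
    have h1 : CC (fun l => ∃ s ≤ m, QQ e i (l.take s) (rs Y s) ∧ good e i (rs Y s)) m ≤
        CC (fun l => QQ e i (l.take s) (rs Y s)) m := by
      refine CC_mono fun l hl => ?_
      rintro ⟨t, ht, hq, hgt⟩
      have hts := hmax t ht hgt
      rw [← take_rs Y ht] at hq
      rw [← take_rs Y hs]
      exact QQ_mono hq hts
    obtain ⟨d, rfl⟩ := Nat.exists_eq_add_of_le hs
    rw [CC_take (fun l => QQ e i l (rs Y s))] at h1
    unfold good cnt at hg
    rw [length_rs] at hg
    calc _ ≤ (2 ^ d * CC (fun l => QQ e i l (rs Y s)) s) * 2 ^ i := Nat.mul_le_mul_right _ h1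
      _ = 2 ^ d * (CC (fun l => QQ e i l (rs Y s)) s * 2 ^ i) := by ring
      _ ≤ 2 ^ d * 2 ^ s := Nat.mul_le_mul_left _ hg.le
      _ = 2 ^ (s + d) := by ring
  · have : CC (fun l => ∃ s ≤ m, QQ e i (l.take s) (rs Y s) ∧ good e i (rs Y s)) m ≤
        CC (fun _ => False) m := CC_mono fun l _ ⟨s, hs, _, hg⟩ => (hex ⟨s, hs, hg⟩).elim
    rw [CC_true] at this
    simp only [if_false, Nat.mul_zero, Nat.le_zero] at this
    rw [this]
    simp

theorem CC_UU (Y : ℕ → Bool) (n m : ℕ) :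
    CC (fun l => ∃ σ ∈ UU Y n, σ <+: l) m * 2 ^ (n + 1) ≤ 2 ^ m := by
  have h1 : CC (fun l => ∃ σ ∈ UU Y n, σ <+: l) m ≤ ∑ e ∈ Finset.range m,
      CC (fun l => ∃ s ≤ m, QQ e (n + e + 2) (l.take s) (rs Y s) ∧
        good e (n + e + 2) (rs Y s)) m := by
    refine le_trans (CC_mono ?_) (CC_union _ m m)
    rintro l hl ⟨σ, ⟨e, he, hq, hg⟩, hσ⟩
    rw [length_rs] at he
    have hlen : σ.length ≤ m := hl ▸ hσ.length_le
    refine ⟨e, by omega, σ.length, hlen, ?_, hg⟩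
    rw [← List.prefix_iff_eq_take.1 hσ]
    exact hq
  have h2 : ∀ e, (CC (fun l => ∃ s ≤ m, QQ e (n + e + 2) (l.take s) (rs Y s) ∧
        good e (n + e + 2) (rs Y s)) m : ℝ) ≤ 2 ^ m / 2 ^ (n + 2) * (1 / 2) ^ e := by
    intro e
    have := CC_piece Y e (n + e + 2) m
    have h3 : (CC (fun l => ∃ s ≤ m, QQ e (n + e + 2) (l.take s) (rs Y s) ∧
        good e (n + e + 2) (rs Y s)) m : ℝ) * 2 ^ (n + e + 2) ≤ 2 ^ m := by exact_mod_cast this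
    have h4 : (2 : ℝ) ^ m / 2 ^ (n + 2) * (1 / 2) ^ e = 2 ^ m / 2 ^ (n + e + 2) := by
      rw [one_div_pow]; field_simp; ring
    rw [h4, le_div_iff₀ (by positivity)]
    exact h3
  have h3 : (CC (fun l => ∃ σ ∈ UU Y n, σ <+: l) m : ℝ) ≤ 2 ^ m / 2 ^ (n + 1) := by
    calc (CC (fun l => ∃ σ ∈ UU Y n, σ <+: l) m : ℝ) ≤
        ((∑ e ∈ Finset.range m, CC (fun l => ∃ s ≤ m, QQ e (n + e + 2) (l.take s) (rs Y s) ∧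
          good e (n + e + 2) (rs Y s)) m : ℕ) : ℝ) := Nat.cast_le.2 h1
      _ ≤ ∑ e ∈ Finset.range m, (2 : ℝ) ^ m / 2 ^ (n + 2) * (1 / 2) ^ e := by
        push_cast
        exact Finset.sum_le_sum fun e _ => h2 e
      _ = (2 : ℝ) ^ m / 2 ^ (n + 2) * ∑ e ∈ Finset.range m, (1 / 2 : ℝ) ^ e := by
        rw [Finset.mul_sum]
      _ ≤ (2 : ℝ) ^ m / 2 ^ (n + 2) * 2 :=
        mul_le_mul_of_nonneg_left (sum_geometric_two_le m) (by positivity)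
      _ = 2 ^ m / 2 ^ (n + 1) := by field_simp; ring
  rw [le_div_iff₀ (by positivity)] at h3
  exact_mod_cast h3

theorem div_lt_iff' (a m i : ℕ) :
    (a : ℝ≥0∞) / 2 ^ m < (2 : ℝ≥0∞)⁻¹ ^ i ↔ a * 2 ^ i < 2 ^ m := by
  rw [← ENNReal.inv_pow, ENNReal.div_lt_iff (by simp) (by simp), mul_comm,
    ← div_eq_mul_inv, ENNReal.lt_div_iff_mul_lt (by simp) (by simp)]
  exact_mod_cast Iff.rfl

theorem div_le_iff' (a m i : ℕ) :
    (a : ℝ≥0∞) / 2 ^ m ≤ (2 : ℝ≥0∞)⁻¹ ^ i ↔ a * 2 ^ i ≤ 2 ^ m := by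
  rw [← ENNReal.inv_pow, ENNReal.div_le_iff (by simp) (by simp), mul_comm,
    ← div_eq_mul_inv, ENNReal.le_div_iff_mul_le (by simp) (by simp)]
  exact_mod_cast Iff.rfl

theorem stringMeasure_UU (Y : ℕ → Bool) (n : ℕ) :
    stringMeasure (UU Y n) < (2 : ℝ≥0∞)⁻¹ ^ n := by
  have h1 : stringMeasure (UU Y n) ≤ (2 : ℝ≥0∞)⁻¹ ^ (n + 1) := by
    refine iSup_le fun m => ?_
    rw [card_eq_CC (fun l => ∃ σ ∈ UU Y n, σ <+: l), div_le_iff']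
    exact CC_UU Y n m
  refine lt_of_le_of_lt h1 ?_
  rw [← ENNReal.inv_pow, ← ENNReal.inv_pow, ENNReal.inv_lt_inv]
  exact_mod_cast Nat.pow_lt_pow_right (by norm_num) (Nat.lt_succ_self n)

theorem CC_lt_of_measure {V : Set (List Bool)} {i : ℕ}
    (h : stringMeasure V < (2 : ℝ≥0∞)⁻¹ ^ i) (m : ℕ) :
    CC (fun l => ∃ σ ∈ V, σ <+: l) m * 2 ^ i < 2 ^ m := by
  rw [← div_lt_iff', ← card_eq_CC (fun l => ∃ σ ∈ V, σ <+: l)]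
  exact lt_of_le_of_lt (le_iSup (fun n : ℕ =>
    (Nat.card {f : Fin n → Bool // ∃ σ ∈ V, σ <+: List.ofFn f} : ℝ≥0∞) / 2 ^ n) m) h

/-! ### Universality of the test -/

theorem rs_succ (Y : ℕ → Bool) (n : ℕ) : rs Y (n + 1) = rs Y n ++ [Y n] := by
  simp [rs, List.range_succ]

theorem rs_of_extends {X : ℕ → Bool} {σ : List Bool} (h : extendsStr X σ) :
    rs X σ.length = σ := by
  apply List.ext_getElem
  · exact length_rs _ _
  · intro i h1 h2
    simpa [rs] using h ⟨i, h2⟩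

theorem extends_rs (X : ℕ → Bool) (n : ℕ) : extendsStr X (rs X n) := by
  rintro ⟨i, hi⟩
  change X i = (rs X n)[i]
  simp only [rs, List.getElem_map, List.getElem_range]

theorem strOracle_rs {Y : ℕ → Bool} {t n : ℕ} (h : n < t) : strOracle (rs Y t) n = chi Y n := by
  have hn : n < (rs Y t).length := by rw [length_rs]; exact h
  have : strOracle (rs Y t) n = Part.some (cond ((rs Y t).get ⟨n, hn⟩) 1 0) := dif_pos hn
  rw [this]
  simp [rs, chi]

theorem strOracle_le {Y : ℕ → Bool} {t n v : ℕ} (h : v ∈ strOracle (rs Y t) n) : v ∈ chi Y n := by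
  by_cases hn : n < t
  · exact strOracle_rs (Y := Y) hn ▸ h
  · have : strOracle (rs Y t) n = Part.none := dif_neg (by rwa [length_rs])
    rw [this] at h
    exact (Part.notMem_none _ h).elim

theorem test_complete {X Y : ℕ → Bool} {V : ℕ → Set (List Bool)} (hV : MLTest Y V)
    (hX : ∀ i, X ∈ openOf (V i)) (n : ℕ) : ∃ s, HH n (rs X s) (rs Y s) := by
  obtain ⟨⟨c, hc⟩, hm⟩ := hV
  set e := c.encodeCode with he
  obtain ⟨σ, hσ, hext⟩ := hX (n + e + 2)
  have hdom := (hc _ _).1 hσ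
  obtain ⟨v, hv⟩ := Part.dom_iff_mem.1 hdom
  have hcont := eval_cont (G := fun t => strOracle (rs Y t)) (g := chi Y) (by
    intro n v h
    filter_upwards [Filter.eventually_gt_atTop n] with t ht
    rw [strOracle_rs ht]; exact h) c _ _ hv
  obtain ⟨t, ht⟩ := hcont.exists
  obtain ⟨k, hk⟩ := (exists_RR c (n + e + 2) σ (rs Y t)).2 (Part.dom_iff_mem.2 ⟨v, ht⟩)
  refine ⟨σ.length + t + k + e + 1, e, ?_, ?_, ?_⟩
  · rw [length_rs]; omega
  · refine ⟨σ.length, ?_, t, ?_, k, ?_, ?_⟩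
    · rw [length_rs]; omega
    · rw [length_rs]; omega
    · rw [length_rs]; omega
    · rw [take_rs _ (by omega), take_rs _ (by omega), rs_of_extends hext]
      exact hk
  · unfold good cnt
    rw [length_rs]
    refine lt_of_le_of_lt (Nat.mul_le_mul_right _ (CC_mono fun l _ => ?_))
      (CC_lt_of_measure (hm (n + e + 2)) _)
    rintro ⟨a, _, b, hb, k, _, h⟩
    rw [length_rs] at hb
    rw [take_rs _ (by omega)] at h
    refine ⟨l.take a, ?_, List.take_prefix _ _⟩
    have h1 := (exists_RR c (n + e + 2) _ _).1 ⟨k, h⟩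
    obtain ⟨w, hw⟩ := Part.dom_iff_mem.1 h1
    exact (hc _ _).2 (Part.dom_iff_mem.2 ⟨w, eval_mono (fun _ _ h => strOracle_le h) c hw⟩)

/-! ### Building the codes -/

theorem exists_snoc : ∃ c : OracleCode, ∀ (g : ℕ →. ℕ) (l : List Bool) (v : ℕ),
    Encodable.encode (l ++ [decide (v = 1)]) ∈
      c.eval g (Nat.pair (Encodable.encode l) v) := by
  have h : Primrec fun p : List Bool × ℕ => p.1 ++ [decide (p.2 = 1)] :=
    Primrec.list_concat.comp Primrec.fst
      ((Primrec.eq.comp Primrec.snd (Primrec.const 1)).decide)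
  obtain ⟨c, hc⟩ := exists_prim_code h
  exact ⟨c, fun g l v => hc g (l, v)⟩

/-- Code appending a bit to a string. -/
noncomputable def cSnoc : OracleCode := exists_snoc.choose

open Classical in
theorem exists_test : ∃ c : OracleCode, ∀ (g : ℕ →. ℕ) (n : ℕ) (ρ τ : List Bool),
    (if HH n ρ τ then 0 else 1) ∈
      c.eval g (Nat.pair n (Nat.pair (Encodable.encode ρ) (Encodable.encode τ))) := by
  have h : Primrec fun p : ℕ × List Bool × List Bool => if HH p.1 p.2.1 p.2.2 then 0 else 1 :=
    Primrec.ite primrec_HH (Primrec.const 0) (Primrec.const 1)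
  obtain ⟨c, hc⟩ := exists_prim_code h
  exact ⟨c, fun g n ρ τ => hc g (n, ρ, τ)⟩

/-- Code deciding `HH`. -/
noncomputable def cTest : OracleCode := exists_test.choose

theorem exists_len : ∃ c : OracleCode, ∀ (g : ℕ →. ℕ) (l : List Bool),
    l.length ∈ c.eval g (Encodable.encode l) := by
  obtain ⟨c, hc⟩ := exists_prim_code (Primrec.list_length (α := Bool))
  exact ⟨c, hc⟩

/-- Code for the identity. -/
def cId : OracleCode := .pair .left .right

theorem mem_left (g : ℕ →. ℕ) (n : ℕ) : n.unpair.1 ∈ OracleCode.left.eval g n := Part.mem_some _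
theorem mem_right (g : ℕ →. ℕ) (n : ℕ) : n.unpair.2 ∈ OracleCode.right.eval g n := Part.mem_some _
theorem mem_left' (g : ℕ →. ℕ) (a b : ℕ) : a ∈ OracleCode.left.eval g (Nat.pair a b) := by
  simpa using mem_left g (Nat.pair a b)
theorem mem_right' (g : ℕ →. ℕ) (a b : ℕ) : b ∈ OracleCode.right.eval g (Nat.pair a b) := by
  simpa using mem_right g (Nat.pair a b)
theorem mem_zero (g : ℕ →. ℕ) (n : ℕ) : 0 ∈ OracleCode.zero.eval g n := Part.mem_some _
theorem mem_id (g : ℕ →. ℕ) (n : ℕ) : n ∈ cId.eval g n :=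
  mem_pair.2 ⟨_, mem_left g n, _, mem_right g n, Nat.pair_unpair n⟩

/-- Code computing (the code of) the length-`s` initial segment of the sequence computed by `d`. -/
noncomputable def cRestr (d : OracleCode) : OracleCode :=
  .comp (.prec .zero (.comp cSnoc (.pair (.comp .right .right) (.comp d (.comp .left .right)))))
    (.pair .zero cId)

theorem mem_restr {d : OracleCode} {g : ℕ →. ℕ} {Y : ℕ → Bool} (hd : d.eval g = chi Y) (s : ℕ) :
    Encodable.encode (rs Y s) ∈ (cRestr d).eval g s := by
  refine mem_comp.2 ⟨Nat.pair 0 s, mem_pair.2 ⟨_, mem_zero _ _, _, mem_id _ _, rfl⟩, ?_⟩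
  induction s with
  | zero => rw [eval_prec_zero]; exact mem_zero _ _
  | succ s ih =>
    refine mem_prec_succ.2 ⟨_, ih, ?_⟩
    refine mem_comp.2 ⟨Nat.pair (Encodable.encode (rs Y s)) (cond (Y s) 1 0), ?_, ?_⟩
    · refine mem_pair.2 ⟨_, mem_comp.2 ⟨_, mem_right' _ _ _, mem_right' _ _ _⟩, _,
        mem_comp.2 ⟨s, mem_comp.2 ⟨_, mem_right' _ _ _, mem_left' _ _ _⟩, ?_⟩, rfl⟩
      rw [hd]
      exact Part.mem_some _
    · have := exists_snoc.choose_spec g (rs Y s) (cond (Y s) 1 0)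
      rw [rs_succ]
      have e : decide ((cond (Y s) 1 0 : ℕ) = 1) = Y s := by cases Y s <;> rfl
      rw [e] at this
      exact this

/-- On `(n, s)`: test whether `X ↾ s` is seen in the `n`-th component relative to `d^X ↾ s`. -/
noncomputable def cStage (d : OracleCode) : OracleCode :=
  .comp cTest (.pair .left (.pair (.comp (cRestr .oracle) .right) (.comp (cRestr d) .right)))

open Classical in
theorem mem_stage {d : OracleCode} {X Y : ℕ → Bool} (hd : d.eval (chi X) = chi Y) (n s : ℕ) :
    (if HH n (rs X s) (rs Y s) then 0 else 1) ∈ (cStage d).eval (chi X) (Nat.pair n s) := by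
  refine mem_comp.2 ⟨_, mem_pair.2 ⟨_, mem_left' _ _ _, _, mem_pair.2
    ⟨_, mem_comp.2 ⟨_, mem_right' _ _ _, mem_restr rfl s⟩,
      _, mem_comp.2 ⟨_, mem_right' _ _ _, mem_restr hd s⟩, rfl⟩, rfl⟩,
      exists_test.choose_spec _ _ _ _⟩

/-- The functional `Ψ` obtained from `d = Φ`. -/
noncomputable def cPsi (d : OracleCode) : OracleCode :=
  .comp .left (.pair d (.comp (.rfind' (cStage d)) (.pair cId .zero)))

theorem psi_sound {d : OracleCode} {X Y : ℕ → Bool} (h : (cPsi d).eval (chi X) = chi Y) :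
    d.eval (chi X) = chi Y ∧ ∀ n, ∃ s, HH n (rs X s) (rs Y s) := by
  classical
  have key : ∀ n, (cond (Y n) 1 0 : ℕ) ∈ d.eval (chi X) n ∧
      ∃ b, b ∈ (OracleCode.rfind' (cStage d)).eval (chi X) (Nat.pair n 0) := by
    intro n
    have hn : (cond (Y n) 1 0 : ℕ) ∈ (cPsi d).eval (chi X) n := by
      rw [h]; exact Part.mem_some _
    obtain ⟨p, hp, hl⟩ := mem_comp.1 hn
    obtain ⟨a, ha, b, hb, rfl⟩ := mem_pair.1 hp
    have := Part.mem_unique hl (mem_left' _ _ _)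
    rw [this]
    refine ⟨ha, b, ?_⟩
    obtain ⟨q, hq, hb⟩ := mem_comp.1 hb
    have e : q = Nat.pair n 0 := Part.mem_unique hq
      (mem_pair.2 ⟨_, mem_id _ _, _, mem_zero _ _, rfl⟩)
    rw [e] at hb
    exact hb
  have hd : d.eval (chi X) = chi Y := by
    funext n
    exact Part.eq_some_iff.2 (key n).1
  refine ⟨hd, fun n => ?_⟩
  obtain ⟨b, hb⟩ := (key n).2
  obtain ⟨k, ⟨h0, _⟩, _⟩ := mem_rfind'.1 hb
  refine ⟨k, ?_⟩
  have h1 := Part.mem_unique h0 (mem_stage hd n (k + 0))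
  by_contra hH
  rw [Nat.add_zero, if_neg hH] at h1
  exact absurd h1 (by norm_num)

theorem psi_complete {d : OracleCode} {X Y : ℕ → Bool} (hd : d.eval (chi X) = chi Y)
    (h : ∀ n, ∃ s, HH n (rs X s) (rs Y s)) : (cPsi d).eval (chi X) = chi Y := by
  classical
  funext n
  refine Part.eq_some_iff.2 ?_
  have hk : Nat.find (h n) + 0 ∈
      (OracleCode.rfind' (cStage d)).eval (chi X) (Nat.pair n 0) := by
    refine mem_rfind'.2 ⟨Nat.find (h n), ⟨?_, fun j hj => ?_⟩, rfl⟩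
    · have := mem_stage hd n (Nat.find (h n))
      rwa [if_pos (Nat.find_spec (h n))] at this
    · refine ⟨1, ?_, one_ne_zero⟩
      have := mem_stage hd n j
      rwa [if_neg (Nat.find_min (h n) hj)] at this
  refine mem_comp.2 ⟨_, mem_pair.2 ⟨(cond (Y n) 1 0 : ℕ), ?_, _,
    mem_comp.2 ⟨_, mem_pair.2 ⟨_, mem_id _ _, _, mem_zero _ _, rfl⟩, hk⟩, rfl⟩, mem_left' _ _ _⟩
  rw [hd]
  exact Part.mem_some _

theorem uniformCE_UU (Y : ℕ → Bool) : UniformCEIn Y (UU Y) := by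
  classical
  obtain ⟨cl, hcl⟩ := exists_len
  let T : OracleCode := .comp cTest (.pair (.comp .left .left) (.pair (.comp .right .left)
    (.comp (cRestr .oracle) (.comp cl (.comp .right .left)))))
  have hT : ∀ n (ρ : List Bool) k, (if HH n ρ (rs Y ρ.length) then 0 else 1) ∈
      T.eval (chi Y) (Nat.pair (Nat.pair n (Encodable.encode ρ)) k) := fun n ρ k =>
    mem_comp.2 ⟨_, mem_pair.2 ⟨_, mem_comp.2 ⟨_, mem_left' _ _ _, mem_left' _ _ _⟩, _,
      mem_pair.2 ⟨_, mem_comp.2 ⟨_, mem_left' _ _ _, mem_right' _ _ _⟩, _,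
        mem_comp.2 ⟨_, mem_comp.2 ⟨_, mem_comp.2 ⟨_, mem_left' _ _ _, mem_right' _ _ _⟩,
          hcl _ ρ⟩, mem_restr rfl _⟩, rfl⟩, rfl⟩, exists_test.choose_spec _ _ _ _⟩
  refine ⟨.comp (.rfind' T) (.pair cId .zero), fun n ρ => ?_⟩
  rw [Part.dom_iff_mem]
  constructor
  · intro h
    have h : HH n ρ (rs Y ρ.length) := h
    refine ⟨0 + 0, mem_comp.2 ⟨_, mem_pair.2 ⟨_, mem_id _ _, _, mem_zero _ _, rfl⟩,
      mem_rfind'.2 ⟨0, ⟨?_, fun j hj => absurd hj (Nat.not_lt_zero j)⟩, rfl⟩⟩⟩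
    have := hT n ρ (0 + 0)
    rwa [if_pos h] at this
  · rintro ⟨v, hv⟩
    obtain ⟨q, hq, hv⟩ := mem_comp.1 hv
    have e := Part.mem_unique hq (mem_pair.2 ⟨_, mem_id _ _, _, mem_zero _ _, rfl⟩)
    rw [e] at hv
    obtain ⟨k, ⟨h0, _⟩, _⟩ := mem_rfind'.1 hv
    have h1 := Part.mem_unique h0 (hT n ρ (k + 0))
    by_contra hH
    have hH : ¬ HH n ρ (rs Y ρ.length) := hH
    rw [if_neg hH] at h1
    exact absurd h1 (by norm_num)

theorem not_random_of {X Y : ℕ → Bool} (h : ∀ n, ∃ s, HH n (rs X s) (rs Y s)) :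
    ¬ MLRandomIn Y X := by
  intro hr
  obtain ⟨n, hn⟩ := hr (UU Y) ⟨uniformCE_UU Y, stringMeasure_UU Y⟩
  obtain ⟨s, hs⟩ := h n
  refine hn ⟨rs X s, ?_, extends_rs X s⟩
  show HH n (rs X s) (rs Y (rs X s).length)
  rwa [length_rs]

/-! ### Effectivity of the construction -/

theorem exists_psiN : ∃ h : ℕ → ℕ, Primrec h ∧
    ∀ d : OracleCode, h d.encodeCode = (cPsi d).encodeCode := by
  open Primrec in
  have hp : ∀ {k : ℕ} {f g : ℕ → ℕ}, Primrec f → Primrec g →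
      Primrec fun e => 4 * Nat.pair (f e) (g e) + k := fun {k f g} hf hg =>
    nat_add.comp (nat_mul.comp (const 4) (Primrec₂.natPair.comp hf hg)) (const k)
  have hR : ∃ h : ℕ → ℕ, Primrec h ∧
      ∀ d : OracleCode, h d.encodeCode = (cRestr d).encodeCode :=
    ⟨_, hp (k := 6) (hp (k := 7) (const _) (hp (k := 6) (const _) (hp (k := 5) (const _)
      (hp (k := 6) .id (const _))))) (const _), fun d => rfl⟩
  obtain ⟨hr, hr1, hr2⟩ := hR
  have hS : ∃ h : ℕ → ℕ, Primrec h ∧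
      ∀ d : OracleCode, h d.encodeCode = (cStage d).encodeCode := by
    refine ⟨_, hp (k := 6) (const cTest.encodeCode) (hp (k := 5) (const OracleCode.left.encodeCode)
      (hp (k := 5) (const (OracleCode.comp (cRestr .oracle) .right).encodeCode)
      (hp (k := 6) hr1 (const OracleCode.right.encodeCode)))), fun d => ?_⟩
    rw [hr2]; rfl
  obtain ⟨hs, hs1, hs2⟩ := hS
  refine ⟨_, hp (k := 6) (const OracleCode.left.encodeCode) (hp (k := 5) .id
    (hp (k := 6) (hp (k := 8) hs1 hs1) (const (OracleCode.pair cId .zero).encodeCode))),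
    fun d => ?_⟩
  rw [hs2]; rfl

/-- For each Turing functional `Φ` there is a Turing functional `Ψ`
such that for all `X`: (a) if `Ψ^X` is total then `Φ^X` is total, `Ψ^X = Φ^X`,
and `X` is not Martin-Löf random relative to `Ψ^X`; (b) if `Φ^X` is total and `X`
is not Martin-Löf random relative to `Φ^X`, then `Ψ^X` is total.  Moreover an
index for `Ψ` is obtained effectively from an index for `Φ`. -/
theorem functionals_and_relative_randomness :
    ∃ h : ℕ → ℕ, ComputableFun h ∧
      ∀ Φ : OracleCode, ∃ Ψ : OracleCode, h Φ.encodeCode = Ψ.encodeCode ∧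
        (∀ X Y : ℕ → Bool, FTotal Ψ X Y → FTotal Φ X Y ∧ ¬ MLRandomIn Y X) ∧
        (∀ X Y : ℕ → Bool, FTotal Φ X Y → ¬ MLRandomIn Y X →
          ∃ Z : ℕ → Bool, FTotal Ψ X Z) := by
  obtain ⟨h, hp, hh⟩ := exists_psiN
  refine ⟨h, ?_, fun Φ => ⟨cPsi Φ, hh Φ, fun X Y hY => ?_, fun X Y hY hr => ?_⟩⟩
  · obtain ⟨c, hc⟩ := exists_prim_code hp
    exact ⟨c, funext fun n => Part.eq_some_iff.2 (hc _ n)⟩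
  · obtain ⟨h1, h2⟩ := psi_sound hY
    exact ⟨h1, not_random_of h2⟩
  · unfold MLRandomIn at hr
    push Not at hr
    obtain ⟨V, hV, hX⟩ := hr
    exact ⟨Y, psi_complete hY (test_complete hV hX)⟩

end TypicalDegree
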